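/- arXiv:1701.04482 — 4 statements merged into one kernel-verified Lean document; each statement's English description precedes it below -/
import Mathlib

section
/- There exists p₀ > 0 such that for every p ∈ (0,p₀) and every λ ∈ (0,1), the ratio #ℬ^λ_p(N) / #𝒞_p(N) tends to 0 as N → +∞. (Any p with 6e√(p(1−p)) < 1 works.) -/
open MeasureTheory ProbabilityTheory Filter

/-- Nearest neighbours in `ℤ²`: points at Euclidean (= ℓ¹) distance 1. -/
def NNbr (i j : ℤ × ℤ) : Prop := (i.1 - j.1).natAbs + (i.2 - j.2).natAbs = 1

/-- `γ : ℕ → ℤ × ℤ` defines a path of length `k`: consecutive points (up to index `k`) are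
nearest neighbours, and the unordered pairs (bonds) traversed are pairwise distinct. -/
def IsPath (k : ℕ) (γ : ℕ → ℤ × ℤ) : Prop :=
  (∀ s < k, NNbr (γ s) (γ (s + 1))) ∧
  ∀ s < k, ∀ t < k, s ≠ t → s(γ s, γ (s + 1)) ≠ s(γ t, γ (t + 1))

/-- The dual bond of a step from `i` to `j`: the pair of endpoints of the common side of the
unit squares `i + [0,1]²` and `j + [0,1]²` (when `i`, `j` are nearest neighbours). -/
def dualBond (i j : ℤ × ℤ) : Sym2 (ℤ × ℤ) :=
  s((max i.1 j.1, max i.2 j.2),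
    (max i.1 j.1 + |i.2 - j.2|, max i.2 j.2 + |i.1 - j.1|))

/-- The number `μ(γ)` of antiferromagnetic bonds crossed by the path `γ` of length `k`,
for the spin configuration `c`. -/
def antiCount (c : Sym2 (ℤ × ℤ) → ℤ) (k : ℕ) (γ : ℕ → ℤ × ℤ) : ℕ :=
  ((Finset.range k).filter fun s => c (dualBond (γ s) (γ (s + 1))) = -1).card

/-- An unordered pair of points of `ℤ²` is a bond if its two points are nearest neighbours. -/
def IsBond (e : Sym2 (ℤ × ℤ)) : Prop := ∃ i j : ℤ × ℤ, NNbr i j ∧ e = s(i, j)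

/-- The set of bonds of `ℤ²`. -/
def Bond : Type := {e : Sym2 (ℤ × ℤ) // IsBond e}

/-- Extend a function defined on bonds to all unordered pairs, by the value 1 off the bonds. -/
noncomputable def extendBond (c : Bond → ℤ) : Sym2 (ℤ × ℤ) → ℤ := fun e => by
  classical exact if h : IsBond e then c ⟨e, h⟩ else 1

/-- Membership in the square `[0,n]²`. -/
def InCube (n : ℕ) (v : ℤ × ℤ) : Prop :=
  0 ≤ v.1 ∧ v.1 ≤ (n : ℤ) ∧ 0 ≤ v.2 ∧ v.2 ≤ (n : ℤ)
/-- A spin system: `±1`-valued on bonds (normalized to `1` off the bonds). -/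
def IsSpinSystem (c : Sym2 (ℤ × ℤ) → ℤ) : Prop :=
  ∀ e : Sym2 (ℤ × ℤ), (IsBond e → c e = 1 ∨ c e = -1) ∧ (¬IsBond e → c e = 1)

/-- `N`-periodicity of a spin system: invariance under the translations `(N,0)` and `(0,N)`. -/
def IsPeriodicSpin (N : ℕ) (c : Sym2 (ℤ × ℤ) → ℤ) : Prop :=
  ∀ i j : ℤ × ℤ,
    c s(i + ((N : ℤ), 0), j + ((N : ℤ), 0)) = c s(i, j) ∧
    c s(i + (0, (N : ℤ)), j + (0, (N : ℤ))) = c s(i, j)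

/-- The `2N²` bonds of the periodicity cell `[0,N]²`: one horizontal and one vertical bond
attached to each of the `N²` points of `[0,N)²`. -/
def cellBonds (N : ℕ) : Finset (Sym2 (ℤ × ℤ)) :=
  ((Finset.range N ×ˢ Finset.range N).image fun q =>
      s(((q.1 : ℤ), (q.2 : ℤ)), ((q.1 : ℤ) + 1, (q.2 : ℤ)))) ∪
  ((Finset.range N ×ˢ Finset.range N).image fun q =>
      s(((q.1 : ℤ), (q.2 : ℤ)), ((q.1 : ℤ), (q.2 : ℤ) + 1)))

/-- `𝒞_p(N)`: the set of `N`-periodic spin systems with exactly `⌊2pN²⌋` antiferromagnetic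
bonds in the periodicity cell `[0,N]²`. -/
def spinClass (p : ℝ) (N : ℕ) : Set (Sym2 (ℤ × ℤ) → ℤ) :=
  {c | IsSpinSystem c ∧ IsPeriodicSpin N c ∧
    ((cellBonds N).filter fun e => c e = -1).card = ⌊2 * p * (N : ℝ) ^ 2⌋₊}

/-- Membership in the square `z + [0,N]²`. -/
def InSquare (z : ℤ × ℤ) (N : ℕ) (v : ℤ × ℤ) : Prop :=
  z.1 ≤ v.1 ∧ v.1 ≤ z.1 + (N : ℤ) ∧ z.2 ≤ v.2 ∧ v.2 ≤ z.2 + (N : ℤ)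

/-- `ℬ^λ_p(N)`: the spin systems of `𝒞_p(N)` admitting a separating path of length `≥ λN`
with all vertices in `[0,N]²`. -/
def badClass (p lam : ℝ) (N : ℕ) : Set (Sym2 (ℤ × ℤ) → ℤ) :=
  {c | c ∈ spinClass p N ∧ ∃ k, ∃ γ : ℕ → ℤ × ℤ, IsPath k γ ∧
    (∀ s ≤ k, InSquare (0, 0) N (γ s)) ∧ lam * (N : ℝ) ≤ (k : ℝ) ∧
    (k : ℝ) / 2 < (antiCount c k γ : ℝ)}

/-- `ℬ̃^λ_p(N)`: the spin systems of `𝒞_p(N)` admitting a separating path of length `≥ λN`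
with all vertices in `z + [0,N]²` for some `z ∈ ℤ²`. -/
def badClassTrans (p lam : ℝ) (N : ℕ) : Set (Sym2 (ℤ × ℤ) → ℤ) :=
  {c | c ∈ spinClass p N ∧ ∃ z : ℤ × ℤ, ∃ k, ∃ γ : ℕ → ℤ × ℤ, IsPath k γ ∧
    (∀ s ≤ k, InSquare z N (γ s)) ∧ lam * (N : ℝ) ≤ (k : ℝ) ∧
    (k : ℝ) / 2 < (antiCount c k γ : ℝ)}

/-- Translation of a bond into the periodicity cell. -/
def cellRep (N : ℕ) (e : Sym2 (ℤ × ℤ)) : Sym2 (ℤ × ℤ) :=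
  s((e.inf.1 % (N : ℤ), e.inf.2 % (N : ℤ)),
    (e.inf.1 % (N : ℤ) + (e.sup.1 - e.inf.1), e.inf.2 % (N : ℤ) + (e.sup.2 - e.inf.2)))

/-- The antiferromagnetic bonds of `c` in the periodicity cell. -/
def antiBonds (N : ℕ) (c : Sym2 (ℤ × ℤ) → ℤ) : Finset (Sym2 (ℤ × ℤ)) :=
  (cellBonds N).filter fun e => c e = -1

lemma NNbr.exists_dualBond {i j : ℤ × ℤ} (h : NNbr i j) : ∃ a b : ℤ,
    (s(i, j) = s((a, b), (a + 1, b)) ∧ i ⊓ j = (a, b) ∧ i ⊔ j = (a + 1, b) ∧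
      dualBond i j = s((a + 1, b), (a + 1, b + 1))) ∨
    (s(i, j) = s((a, b), (a, b + 1)) ∧ i ⊓ j = (a, b) ∧ i ⊔ j = (a, b + 1) ∧
      dualBond i j = s((a, b + 1), (a + 1, b + 1))) := by
  obtain ⟨i1, i2⟩ := i
  obtain ⟨j1, j2⟩ := j
  simp only [NNbr] at h
  have h4 : (j1 = i1 + 1 ∧ j2 = i2) ∨ (i1 = j1 + 1 ∧ j2 = i2) ∨ (j1 = i1 ∧ j2 = i2 + 1) ∨
      (j1 = i1 ∧ i2 = j2 + 1) := by omega
  rcases h4 with ⟨rfl, rfl⟩ | ⟨rfl, rfl⟩ | ⟨rfl, rfl⟩ | ⟨rfl, rfl⟩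
  · exact ⟨i1, j2, Or.inl (by simp [dualBond])⟩
  · exact ⟨j1, j2, Or.inl (by simp [dualBond, Sym2.eq_swap])⟩
  · exact ⟨j1, i2, Or.inr (by simp [dualBond])⟩
  · exact ⟨j1, j2, Or.inr (by simp [dualBond, Sym2.eq_swap])⟩

lemma IsBond.exists_eq {e : Sym2 (ℤ × ℤ)} (h : IsBond e) :
    ∃ a b : ℤ, e = s((a, b), (a + 1, b)) ∨ e = s((a, b), (a, b + 1)) := by
  obtain ⟨i, j, hij, rfl⟩ := h
  obtain ⟨a, b, h | h⟩ := hij.exists_dualBond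
  · exact ⟨a, b, Or.inl h.1⟩
  · exact ⟨a, b, Or.inr h.1⟩

lemma isBond_horizontal (a b : ℤ) : IsBond s((a, b), (a + 1, b)) :=
  ⟨_, _, by simp [NNbr], rfl⟩

lemma isBond_vertical (a b : ℤ) : IsBond s((a, b), (a, b + 1)) :=
  ⟨_, _, by simp [NNbr], rfl⟩

lemma NNbr.isBond_dualBond {i j : ℤ × ℤ} (h : NNbr i j) : IsBond (dualBond i j) := by
  obtain ⟨a, b, ⟨-, -, -, h⟩ | ⟨-, -, -, h⟩⟩ := h.exists_dualBond
  · exact h ▸ isBond_vertical _ _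
  · exact h ▸ isBond_horizontal _ _

lemma cellRep_horizontal (N : ℕ) (a b : ℤ) :
    cellRep N s((a, b), (a + 1, b)) = s((a % N, b % N), (a % N + 1, b % N)) := by
  simp [cellRep]

lemma cellRep_vertical (N : ℕ) (a b : ℤ) :
    cellRep N s((a, b), (a, b + 1)) = s((a % N, b % N), (a % N, b % N + 1)) := by
  simp [cellRep]

lemma horizontal_mem_cellBonds {N : ℕ} {a b : ℤ} (ha : 0 ≤ a) (ha' : a < N) (hb : 0 ≤ b)
    (hb' : b < N) : s((a, b), (a + 1, b)) ∈ cellBonds N := by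
  lift a to ℕ using ha
  lift b to ℕ using hb
  refine Finset.mem_union_left _ (Finset.mem_image.2 ⟨(a, b), ?_, rfl⟩)
  simp only [Finset.mem_product, Finset.mem_range]
  omega

lemma vertical_mem_cellBonds {N : ℕ} {a b : ℤ} (ha : 0 ≤ a) (ha' : a < N) (hb : 0 ≤ b)
    (hb' : b < N) : s((a, b), (a, b + 1)) ∈ cellBonds N := by
  lift a to ℕ using ha
  lift b to ℕ using hb
  refine Finset.mem_union_right _ (Finset.mem_image.2 ⟨(a, b), ?_, rfl⟩)
  simp only [Finset.mem_product, Finset.mem_range]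
  omega

lemma cellBonds_cases {N : ℕ} {e : Sym2 (ℤ × ℤ)} (h : e ∈ cellBonds N) :
    ∃ a b : ℤ, 0 ≤ a ∧ a < N ∧ 0 ≤ b ∧ b < N ∧
      (e = s((a, b), (a + 1, b)) ∨ e = s((a, b), (a, b + 1))) := by
  simp only [cellBonds, Finset.mem_union, Finset.mem_image, Finset.mem_product,
    Finset.mem_range] at h
  obtain ⟨⟨a, b⟩, ⟨ha, hb⟩, rfl⟩ | ⟨⟨a, b⟩, ⟨ha, hb⟩, rfl⟩ := h
  · exact ⟨a, b, by positivity, by exact_mod_cast ha, by positivity, by exact_mod_cast hb,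
      Or.inl rfl⟩
  · exact ⟨a, b, by positivity, by exact_mod_cast ha, by positivity, by exact_mod_cast hb,
      Or.inr rfl⟩

lemma isBond_of_mem_cellBonds {N : ℕ} {e : Sym2 (ℤ × ℤ)} (h : e ∈ cellBonds N) :
    IsBond e := by
  obtain ⟨a, b, -, -, -, -, rfl | rfl⟩ := cellBonds_cases h
  · exact isBond_horizontal a b
  · exact isBond_vertical a b

lemma cellRep_of_mem_cellBonds {N : ℕ} {e : Sym2 (ℤ × ℤ)} (h : e ∈ cellBonds N) :
    cellRep N e = e := by
  obtain ⟨a, b, ha, ha', hb, hb', rfl | rfl⟩ := cellBonds_cases h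
  · rw [cellRep_horizontal, Int.emod_eq_of_lt ha ha', Int.emod_eq_of_lt hb hb']
  · rw [cellRep_vertical, Int.emod_eq_of_lt ha ha', Int.emod_eq_of_lt hb hb']

lemma IsBond.cellRep_mem {N : ℕ} (hN : 0 < N) {e : Sym2 (ℤ × ℤ)} (h : IsBond e) :
    cellRep N e ∈ cellBonds N := by
  have hN' : (0 : ℤ) < N := by exact_mod_cast hN
  obtain ⟨a, b, rfl | rfl⟩ := h.exists_eq
  · rw [cellRep_horizontal]
    exact horizontal_mem_cellBonds (Int.emod_nonneg _ hN'.ne') (Int.emod_lt_of_pos _ hN')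
      (Int.emod_nonneg _ hN'.ne') (Int.emod_lt_of_pos _ hN')
  · rw [cellRep_vertical]
    exact vertical_mem_cellBonds (Int.emod_nonneg _ hN'.ne') (Int.emod_lt_of_pos _ hN')
      (Int.emod_nonneg _ hN'.ne') (Int.emod_lt_of_pos _ hN')

lemma IsPeriodicSpin.translate {N : ℕ} {c : Sym2 (ℤ × ℤ) → ℤ} (hc : IsPeriodicSpin N c)
    (i j : ℤ × ℤ) (x y : ℤ) :
    c s(i + (N * x, N * y), j + (N * x, N * y)) = c s(i, j) := by
  have hx : ∀ (x : ℤ) (i j : ℤ × ℤ), c s(i + (N * x, 0), j + (N * x, 0)) = c s(i, j) := by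
    intro x
    induction x using Int.induction_on with
    | zero => simp
    | succ n ih =>
      intro i j
      rw [← ih i j, ← (hc (i + (N * (n : ℤ), 0)) (j + (N * (n : ℤ), 0))).1]
      simp [add_assoc, mul_add]
    | pred n ih =>
      intro i j
      rw [← ih i j, ← (hc (i + (N * (-(n : ℤ) - 1), 0)) (j + (N * (-(n : ℤ) - 1), 0))).1]
      simp [add_assoc, mul_sub]
  have hy : ∀ (y : ℤ) (i j : ℤ × ℤ), c s(i + (0, N * y), j + (0, N * y)) = c s(i, j) := by
    intro y
    induction y using Int.induction_on with
    | zero => simp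
    | succ n ih =>
      intro i j
      rw [← ih i j, ← (hc (i + (0, N * (n : ℤ))) (j + (0, N * (n : ℤ)))).2]
      simp [add_assoc, mul_add]
    | pred n ih =>
      intro i j
      rw [← ih i j, ← (hc (i + (0, N * (-(n : ℤ) - 1))) (j + (0, N * (-(n : ℤ) - 1)))).2]
      simp [add_assoc, mul_sub]
  rw [← hx x i j, ← hy y (i + (N * x, 0))]
  simp [add_assoc]

lemma IsPeriodicSpin.apply_cellRep {N : ℕ} {c : Sym2 (ℤ × ℤ) → ℤ} (hc : IsPeriodicSpin N c)
    {e : Sym2 (ℤ × ℤ)} (he : IsBond e) : c (cellRep N e) = c e := by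
  obtain ⟨a, b, rfl | rfl⟩ := he.exists_eq
  · rw [cellRep_horizontal, ← hc.translate _ _ (a / N) (b / N)]
    simp only [Prod.mk_add_mk, add_right_comm _ (1 : ℤ), Int.emod_add_mul_ediv]
  · rw [cellRep_vertical, ← hc.translate _ _ (a / N) (b / N)]
    simp only [Prod.mk_add_mk, add_right_comm _ (1 : ℤ), Int.emod_add_mul_ediv]

lemma card_cellBonds (N : ℕ) : (cellBonds N).card = 2 * N ^ 2 := by
  rw [cellBonds, Finset.card_union_of_disjoint, Finset.card_image_of_injective,
    Finset.card_image_of_injective]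
  · simp
    ring
  · rintro ⟨a, b⟩ ⟨a', b'⟩ h
    simp only [Sym2.eq_iff, Prod.mk.injEq] at h ⊢
    omega
  · rintro ⟨a, b⟩ ⟨a', b'⟩ h
    simp only [Sym2.eq_iff, Prod.mk.injEq] at h ⊢
    omega
  · rw [Finset.disjoint_left]
    simp only [Finset.mem_image, not_exists, not_and]
    rintro _ ⟨⟨a, b⟩, -, rfl⟩ ⟨a', b'⟩ - h
    simp only [Sym2.eq_iff, Prod.mk.injEq] at h
    omega

lemma cellRep_add (N : ℕ) (i j : ℤ × ℤ) (x y : ℤ) :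
    cellRep N s(i + (N * x, N * y), j + (N * x, N * y)) = cellRep N s(i, j) := by
  obtain ⟨i1, i2⟩ := i
  obtain ⟨j1, j2⟩ := j
  simp [cellRep, max_add_add_right, min_add_add_right]

lemma isBond_add_iff (i j v : ℤ × ℤ) : IsBond s(i + v, j + v) ↔ IsBond s(i, j) := by
  have key : ∀ i j : ℤ × ℤ, IsBond s(i, j) ↔ NNbr i j := by
    intro i j
    refine ⟨?_, fun h => ⟨i, j, h, rfl⟩⟩
    rintro ⟨i', j', h, h'⟩
    rcases Sym2.eq_iff.1 h' with ⟨rfl, rfl⟩ | ⟨rfl, rfl⟩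
    · exact h
    · simp only [NNbr] at h ⊢
      omega
  simp [key, NNbr]

open Classical in
lemma image_antiBonds_spinClass (p : ℝ) (N : ℕ) :
    antiBonds N '' spinClass p N =
      ((cellBonds N).powersetCard ⌊2 * p * (N : ℝ) ^ 2⌋₊ : Finset _) := by
  ext A
  simp only [Set.mem_image, Finset.mem_coe, Finset.mem_powersetCard]
  constructor
  · rintro ⟨c, ⟨-, -, hc⟩, rfl⟩
    exact ⟨Finset.filter_subset _ _, hc⟩
  · rintro ⟨hA, hcard⟩
    let c : Sym2 (ℤ × ℤ) → ℤ := fun e => if IsBond e ∧ cellRep N e ∈ A then -1 else 1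
    have hanti : antiBonds N c = A := by
      ext e
      simp only [antiBonds, Finset.mem_filter, c]
      constructor
      · rintro ⟨he, h⟩
        by_contra hn
        rw [cellRep_of_mem_cellBonds he, if_neg (by tauto)] at h
        norm_num at h
      · intro he
        refine ⟨hA he, if_pos ⟨isBond_of_mem_cellBonds (hA he), ?_⟩⟩
        rwa [cellRep_of_mem_cellBonds (hA he)]
    refine ⟨c, ⟨fun e => ⟨fun he => ?_, fun he => if_neg (by tauto)⟩, fun i j => ⟨?_, ?_⟩, ?_⟩,
      hanti⟩
    · simp only [c]
      split_ifs <;> simp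
    · have h := cellRep_add N i j 1 0
      simp only [mul_one, mul_zero] at h
      simp only [c, h, isBond_add_iff]
    · have h := cellRep_add N i j 0 1
      simp only [mul_one, mul_zero] at h
      simp only [c, h, isBond_add_iff]
    · rw [← hcard]
      exact congrArg Finset.card hanti

lemma injOn_antiBonds_spinClass {p : ℝ} {N : ℕ} (hN : 0 < N) :
    Set.InjOn (antiBonds N) (spinClass p N) := by
  rintro c ⟨hc, hper, -⟩ c' ⟨hc', hper', -⟩ h
  funext e
  by_cases he : IsBond e
  · rw [← hper.apply_cellRep he, ← hper'.apply_cellRep he]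
    have hmem := he.cellRep_mem hN
    have hiff : c (cellRep N e) = -1 ↔ c' (cellRep N e) = -1 := by
      have := Finset.ext_iff.1 h (cellRep N e)
      simpa [antiBonds, hmem] using this
    have hb := isBond_of_mem_cellBonds hmem
    rcases (hc _).1 hb with h1 | h1 <;> rcases (hc' _).1 hb with h2 | h2 <;>
      simp [h1, h2] at hiff ⊢
  · rw [(hc e).2 he, (hc' e).2 he]

lemma card_spinClass {p : ℝ} {N : ℕ} (hN : 0 < N) :
    Nat.card (spinClass p N) = (2 * N ^ 2).choose ⌊2 * p * (N : ℝ) ^ 2⌋₊ := by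
  rw [← card_cellBonds, ← Finset.card_powersetCard, ← Set.ncard_coe_finset,
    ← image_antiBonds_spinClass, (injOn_antiBonds_spinClass hN).ncard_image]
  rfl

lemma eq_of_cellRep_dualBond_eq {N : ℕ} {i j i' j' : ℤ × ℤ} (h : NNbr i j) (h' : NNbr i' j')
    (hi : InSquare (0, 0) N i) (hj : InSquare (0, 0) N j)
    (hi' : InSquare (0, 0) N i') (hj' : InSquare (0, 0) N j')
    (hrep : cellRep N (dualBond i j) = cellRep N (dualBond i' j'))
    (htag : ((i ⊓ j).1 = N ∨ (i ⊓ j).2 = N) ↔ ((i' ⊓ j').1 = N ∨ (i' ⊓ j').2 = N)) :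
    s(i, j) = s(i', j') := by
  have emod_inj : ∀ x y : ℤ, 0 ≤ x → x ≤ N → 0 ≤ y → y ≤ N → x % N = y % N →
      (x = y ∨ (x = 0 ∧ y = N) ∨ (x = N ∧ y = 0)) := by
    intro x y hx hxN hy hyN hxy
    rcases hxN.lt_or_eq with hx' | rfl <;> rcases hyN.lt_or_eq with hy' | rfl
    · rw [Int.emod_eq_of_lt hx hx', Int.emod_eq_of_lt hy hy'] at hxy
      exact Or.inl hxy
    · rw [Int.emod_eq_of_lt hx hx', Int.emod_self] at hxy
      omega
    · rw [Int.emod_eq_of_lt hy hy', Int.emod_self] at hxy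
      omega
    · exact Or.inl rfl
  have bounds : ∀ u v : ℤ × ℤ, InSquare (0, 0) N u → InSquare (0, 0) N v →
      0 ≤ (u ⊓ v).1 ∧ 0 ≤ (u ⊓ v).2 ∧ (u ⊔ v).1 ≤ N ∧ (u ⊔ v).2 ≤ N := by
    intro u v hu hv
    simp only [InSquare, zero_add] at hu hv
    simp only [Prod.fst_inf, Prod.snd_inf, Prod.fst_sup, Prod.snd_sup, le_inf_iff, sup_le_iff]
    tauto
  have hb := bounds i j hi hj
  have hb' := bounds i' j' hi' hj'
  obtain ⟨a, b, ⟨e, e1, e2, e3⟩ | ⟨e, e1, e2, e3⟩⟩ := h.exists_dualBond <;>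
  obtain ⟨a', b', ⟨f, f1, f2, f3⟩ | ⟨f, f1, f2, f3⟩⟩ := h'.exists_dualBond <;>
  rw [e1, e2] at hb <;> rw [f1, f2] at hb' <;> rw [e1, f1] at htag <;> rw [e3, f3] at hrep <;>
  rw [e, f] <;>
  simp only [cellRep_horizontal, cellRep_vertical, Sym2.eq_iff, Prod.mk.injEq] at hrep hb hb' htag ⊢
  · have h1 := emod_inj (a + 1) (a' + 1) (by omega) (by omega) (by omega) (by omega) (by omega)
    have h2 := emod_inj b b' (by omega) (by omega) (by omega) (by omega) (by omega)
    omega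
  · omega
  · omega
  · have h1 := emod_inj a a' (by omega) (by omega) (by omega) (by omega) (by omega)
    have h2 := emod_inj (b + 1) (b' + 1) (by omega) (by omega) (by omega) (by omega) (by omega)
    omega

lemma card_antiCount_le_two_mul {N k : ℕ} {γ : ℕ → ℤ × ℤ} (hγ : IsPath k γ)
    (hsq : ∀ s ≤ k, InSquare (0, 0) N (γ s)) (A : Finset ℕ) (hA : A ⊆ Finset.range k) :
    A.card ≤ 2 * (A.image fun s => cellRep N (dualBond (γ s) (γ (s + 1)))).card := by
  have hcard : A.card ≤ ((A.image fun s => cellRep N (dualBond (γ s) (γ (s + 1)))) ×ˢ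
      (Finset.univ : Finset Bool)).card := by
    refine Finset.card_le_card_of_injOn
      (fun s => (cellRep N (dualBond (γ s) (γ (s + 1))),
        decide ((γ s ⊓ γ (s + 1)).1 = N ∨ (γ s ⊓ γ (s + 1)).2 = N))) ?_ ?_
    · intro s hs
      simp only [Finset.coe_product, Set.mem_prod, Finset.mem_coe, Finset.mem_univ, and_true]
      exact Finset.mem_image_of_mem _ hs
    · intro s hs t ht hst
      have hs' := Finset.mem_range.1 (hA hs)
      have ht' := Finset.mem_range.1 (hA ht)
      simp only [Prod.mk.injEq, decide_eq_decide] at hst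
      by_contra hne
      exact hγ.2 s hs' t ht' hne (eq_of_cellRep_dualBond_eq (hγ.1 s hs') (hγ.1 t ht')
        (hsq _ (by omega)) (hsq _ (by omega)) (hsq _ (by omega)) (hsq _ (by omega))
        hst.1 hst.2)
  simpa [mul_comm] using hcard

lemma IsPath.length_le {N k : ℕ} {γ : ℕ → ℤ × ℤ} (hγ : IsPath k γ)
    (hsq : ∀ s ≤ k, InSquare (0, 0) N (γ s)) : k ≤ (N + 1) ^ 4 := by
  let Q : Finset (ℤ × ℤ) := Finset.Icc 0 (N : ℤ) ×ˢ Finset.Icc 0 (N : ℤ)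
  have hQ : ∀ s ≤ k, γ s ∈ Q := by
    intro s hs
    have := hsq s hs
    simp only [InSquare, zero_add] at this
    simp only [Q, Finset.mem_product, Finset.mem_Icc]
    tauto
  have hcard : (Finset.range k).card ≤ (Q ×ˢ Q).card := by
    refine Finset.card_le_card_of_injOn (fun s => (γ s, γ (s + 1))) ?_ ?_
    · intro s hs
      have := Finset.mem_range.1 hs
      exact Finset.mem_product.2 ⟨hQ s (by omega), hQ (s + 1) (by omega)⟩
    · intro s hs t ht hst
      simp only [Prod.mk.injEq] at hst
      by_contra hne
      exact hγ.2 s (Finset.mem_range.1 hs) t (Finset.mem_range.1 ht) hne (by rw [hst.1, hst.2])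
  have hQc : Q.card = (N + 1) * (N + 1) := by simp [Q, Finset.card_product]
  rw [Finset.card_range, Finset.card_product, hQc] at hcard
  calc k ≤ _ := hcard
    _ = (N + 1) ^ 4 := by ring

/-- The four unit steps of `ℤ²`. -/
def unitSteps : Finset (ℤ × ℤ) := {(1, 0), (-1, 0), (0, 1), (0, -1)}

lemma NNbr.sub_mem_unitSteps {i j : ℤ × ℤ} (h : NNbr i j) : j - i ∈ unitSteps := by
  obtain ⟨i1, i2⟩ := i
  obtain ⟨j1, j2⟩ := j
  simp only [NNbr] at h
  simp only [unitSteps, Finset.mem_insert, Finset.mem_singleton, Prod.mk_sub_mk, Prod.mk.injEq]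
  omega

/-- The walk starting at `v` with the given steps, constant after time `k`. -/
def walkOf {k : ℕ} (v : ℤ × ℤ) (w : Fin k → (ℤ × ℤ) × Bool) (s : ℕ) : ℤ × ℤ :=
  v + ∑ t ∈ Finset.range s, if h : t < k then (w ⟨t, h⟩).1 else 0

/-- The cell representatives of the dual bonds of the marked steps of a walk. -/
def markedBonds (N : ℕ) {k : ℕ} (x : (ℤ × ℤ) × (Fin k → (ℤ × ℤ) × Bool)) :
    Finset (Sym2 (ℤ × ℤ)) :=
  ((Finset.univ : Finset (Fin k)).filter fun s => (x.2 s).2 = true).image fun s : Fin k =>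
    cellRep N (dualBond (walkOf x.1 x.2 s) (walkOf x.1 x.2 (s + 1)))

/-- The sets of at least `k / 4` cell bonds marked along walks of length `k` starting in the
square `[0,N]²`. -/
noncomputable def candidates (N k : ℕ) : Finset (Finset (Sym2 (ℤ × ℤ))) :=
  (((Finset.Icc 0 (N : ℤ) ×ˢ Finset.Icc 0 (N : ℤ)) ×ˢ
    Fintype.piFinset fun _ : Fin k => unitSteps ×ˢ (Finset.univ : Finset Bool)).image
      (markedBonds N)).filter fun S => k ≤ 4 * S.card

lemma card_candidates_le (N k : ℕ) : (candidates N k).card ≤ (N + 1) ^ 2 * 8 ^ k := by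
  refine (Finset.card_filter_le _ _).trans (Finset.card_image_le.trans ?_)
  have : unitSteps.card = 4 := by decide
  simp [Finset.card_product, this, sq]

lemma exists_candidate {p lam : ℝ} {N : ℕ} (hN : 0 < N) {c : Sym2 (ℤ × ℤ) → ℤ}
    (hc : c ∈ badClass p lam N) :
    ∃ k ∈ Finset.Icc ⌈lam * N⌉₊ ((N + 1) ^ 4), ∃ S ∈ candidates N k, S ⊆ antiBonds N c := by
  obtain ⟨⟨-, hper, -⟩, k, γ, hγ, hsq, hlen, hμ⟩ := hc
  refine ⟨k, Finset.mem_Icc.2 ⟨Nat.ceil_le.2 hlen, hγ.length_le hsq⟩, ?_⟩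
  let A := (Finset.range k).filter fun s => c (dualBond (γ s) (γ (s + 1))) = -1
  let w : Fin k → (ℤ × ℤ) × Bool := fun s =>
    (γ (s + 1) - γ s, decide (c (dualBond (γ s) (γ (s + 1))) = -1))
  have hwalk : ∀ s ≤ k, walkOf (γ 0) w s = γ s := by
    intro s hs
    have : ∑ t ∈ Finset.range s, (if h : t < k then (w ⟨t, h⟩).1 else 0) =
        ∑ t ∈ Finset.range s, (γ (t + 1) - γ t) := by
      refine Finset.sum_congr rfl fun t ht => ?_
      rw [dif_pos (by have := Finset.mem_range.1 ht; omega)]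
    rw [walkOf, this, Finset.sum_range_sub]
    abel
  have hmark : ∀ s : Fin k, (w s).2 = true ↔ c (dualBond (γ s) (γ (s + 1))) = -1 :=
    fun s => decide_eq_true_iff
  have himage : markedBonds N (γ 0, w) =
      A.image fun s => cellRep N (dualBond (γ s) (γ (s + 1))) := by
    ext e
    simp only [markedBonds, A, Finset.mem_image, Finset.mem_filter, Finset.mem_univ, true_and,
      Finset.mem_range, hmark]
    constructor
    · rintro ⟨⟨s, hs⟩, h, rfl⟩
      exact ⟨s, ⟨hs, h⟩, by rw [hwalk s hs.le, hwalk (s + 1) hs]⟩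
    · rintro ⟨s, ⟨hs, h⟩, rfl⟩
      exact ⟨⟨s, hs⟩, h, by rw [hwalk s hs.le, hwalk (s + 1) hs]⟩
  refine ⟨markedBonds N (γ 0, w), Finset.mem_filter.2 ⟨Finset.mem_image_of_mem _ ?_, ?_⟩, ?_⟩
  · have h0 := hsq 0 (Nat.zero_le _)
    simp only [InSquare, zero_add] at h0
    simp only [Finset.mem_product, Finset.mem_Icc, Fintype.mem_piFinset, Finset.mem_univ,
      and_true]
    exact ⟨by tauto, fun s => (hγ.1 s s.2).sub_mem_unitSteps⟩
  · have h2 := card_antiCount_le_two_mul hγ hsq A (Finset.filter_subset _ _)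
    have h1 : k < 2 * A.card := by
      have : (k : ℝ) < 2 * (A.card : ℝ) := by
        have : (k : ℝ) / 2 < (A.card : ℝ) := hμ
        linarith
      exact_mod_cast this
    rw [himage]
    omega
  · rw [himage]
    intro e he
    obtain ⟨s, hs, rfl⟩ := Finset.mem_image.1 he
    obtain ⟨hs, hcs⟩ := Finset.mem_filter.1 hs
    have hb := (hγ.1 s (Finset.mem_range.1 hs)).isBond_dualBond
    exact Finset.mem_filter.2 ⟨hb.cellRep_mem hN, by rw [hper.apply_cellRep hb, hcs]⟩

lemma choose_le_pow_mul_choose_add {p : ℝ} (hp0 : 0 ≤ p) (hp1 : p ≤ 1) (n m j : ℕ)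
    (h : ((m + j : ℕ) : ℝ) ≤ p * (n + j : ℕ)) :
    (n.choose m : ℝ) ≤ p ^ j * ((n + j).choose (m + j) : ℝ) := by
  induction j with
  | zero => simp
  | succ j ih =>
    push_cast at h ih
    have ih := ih (by linarith)
    have hid : (((n + j : ℕ) : ℝ) + 1) * ((n + j).choose (m + j) : ℝ) =
        ((n + j + 1).choose (m + j + 1) : ℝ) * ((m + j : ℕ) + 1) := by
      exact_mod_cast Nat.add_one_mul_choose_eq (n + j) (m + j)
    push_cast at hid
    have hpos : (0 : ℝ) < (n : ℝ) + j + 1 := by positivity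
    have hstep : ((n + j).choose (m + j) : ℝ) ≤ p * ((n + j + 1).choose (m + j + 1) : ℝ) := by
      refine le_of_mul_le_mul_left ?_ hpos
      rw [hid]
      have := mul_le_mul_of_nonneg_left h
        (Nat.cast_nonneg (α := ℝ) ((n + j + 1).choose (m + j + 1)))
      linarith
    calc (n.choose m : ℝ) ≤ p ^ j * ((n + j).choose (m + j) : ℝ) := ih
      _ ≤ p ^ j * (p * ((n + j + 1).choose (m + j + 1) : ℝ)) := by gcongr
      _ = p ^ (j + 1) * ((n + (j + 1)).choose (m + (j + 1)) : ℝ) := by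
        rw [pow_succ, mul_assoc]
        rfl

lemma card_filter_superset_le {α : Type*} [DecidableEq α] (E S : Finset α) (m : ℕ) {p : ℝ}
    (hp0 : 0 ≤ p) (hp1 : p ≤ 1) (hm : (m : ℝ) ≤ p * E.card) :
    (((E.powersetCard m).filter fun A => S ⊆ A).card : ℝ) ≤
      p ^ S.card * (E.card.choose m : ℝ) := by
  by_cases h : S ⊆ E ∧ S.card ≤ m
  · obtain ⟨hSE, hSm⟩ := h
    obtain ⟨m', rfl⟩ := Nat.exists_eq_add_of_le' hSm
    have hE : E.card = (E \ S).card + S.card := (Finset.card_sdiff_add_card_eq_card hSE).symm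
    have hle : ((E.powersetCard (m' + S.card)).filter fun A => S ⊆ A).card ≤
        ((E \ S).powersetCard m').card := by
      refine Finset.card_le_card_of_injOn (fun A => A \ S) ?_ ?_
      · intro A hA
        simp only [Finset.coe_filter, Finset.mem_powersetCard, Set.mem_ofPred_eq] at hA
        simp only [Finset.mem_coe, Finset.mem_powersetCard]
        refine ⟨Finset.sdiff_subset_sdiff hA.1.1 subset_rfl, ?_⟩
        rw [Finset.card_sdiff_of_subset hA.2, hA.1.2]
        omega
      · intro A hA B hB hAB
        simp only [Finset.coe_filter, Set.mem_ofPred_eq] at hA hB hAB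
        rw [← Finset.sdiff_union_of_subset hA.2, hAB, Finset.sdiff_union_of_subset hB.2]
    rw [Finset.card_powersetCard] at hle
    rw [hE] at hm ⊢
    exact (Nat.cast_le.2 hle).trans (choose_le_pow_mul_choose_add hp0 hp1 _ _ _ hm)
  · have hempty : ((E.powersetCard m).filter fun A => S ⊆ A) = ∅ := by
      refine Finset.filter_eq_empty_iff.2 fun A hA hSA => h ?_
      obtain ⟨hAE, rfl⟩ := Finset.mem_powersetCard.1 hA
      exact ⟨hSA.trans hAE, Finset.card_le_card hSA⟩
    rw [hempty]
    simp only [Finset.card_empty, Nat.cast_zero]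
    positivity

lemma card_badClass_le {p lam : ℝ} {N : ℕ} (hN : 0 < N) (hp0 : 0 ≤ p) (hp : p ≤ (1 / 16) ^ 4) :
    (Nat.card (badClass p lam N) : ℝ) ≤
      ((N + 1) ^ 4 + 1) * (N + 1) ^ 2 * (1 / 2) ^ ⌈lam * N⌉₊ * Nat.card (spinClass p N) := by
  have hp1 : p ≤ 1 := hp.trans (by norm_num)
  set m := ⌊2 * p * (N : ℝ) ^ 2⌋₊ with hm
  set K := Finset.Icc ⌈lam * N⌉₊ ((N + 1) ^ 4) with hK
  let T : Finset (Finset (Sym2 (ℤ × ℤ))) := K.biUnion fun k => (candidates N k).biUnion fun S =>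
    ((cellBonds N).powersetCard m).filter fun A => S ⊆ A
  have hbad : Nat.card (badClass p lam N) ≤ T.card := by
    rw [← Set.ncard_coe_finset]
    refine Set.ncard_le_ncard_of_injOn (antiBonds N) ?_
      ((injOn_antiBonds_spinClass hN).mono fun c hc => hc.1) (Finset.finite_toSet T)
    intro c hc
    obtain ⟨k, hk, S, hS, hSc⟩ := exists_candidate hN hc
    have hmem : antiBonds N c ∈ (cellBonds N).powersetCard m := by
      have := Set.mem_image_of_mem (antiBonds N) hc.1
      rwa [image_antiBonds_spinClass] at this
    simp only [T, Finset.mem_coe, Finset.mem_biUnion, Finset.mem_filter]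
    exact ⟨k, hk, S, hS, hmem, hSc⟩
  set C : ℝ := (Nat.card (spinClass p N) : ℝ) with hC
  have hCS : ∀ k, ∀ S ∈ candidates N k,
      ((((cellBonds N).powersetCard m).filter fun A => S ⊆ A).card : ℝ) ≤ (1 / 16) ^ k * C := by
    intro k S hS
    have hk : k ≤ 4 * S.card := (Finset.mem_filter.1 hS).2
    have hmle : (m : ℝ) ≤ p * (cellBonds N).card := by
      rw [card_cellBonds]
      refine (Nat.floor_le (by positivity)).trans_eq ?_
      push_cast
      ring
    refine (card_filter_superset_le _ S m hp0 hp1 hmle).trans ?_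
    rw [hC, card_spinClass hN, card_cellBonds]
    gcongr
    calc p ^ S.card ≤ ((1 / 16) ^ 4) ^ S.card := by gcongr
      _ = (1 / 16) ^ (4 * S.card) := (pow_mul _ _ _).symm
      _ ≤ (1 / 16) ^ k := pow_le_pow_of_le_one (by norm_num) (by norm_num) hk
  have hk : ∀ k ∈ K, ((((candidates N k).biUnion fun S =>
      ((cellBonds N).powersetCard m).filter fun A => S ⊆ A).card : ℕ) : ℝ) ≤
        (N + 1) ^ 2 * (1 / 2) ^ ⌈lam * N⌉₊ * C := by
    intro k hk
    calc ((((candidates N k).biUnion fun S =>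
          ((cellBonds N).powersetCard m).filter fun A => S ⊆ A).card : ℕ) : ℝ)
        ≤ ∑ S ∈ candidates N k,
          ((((cellBonds N).powersetCard m).filter fun A => S ⊆ A).card : ℝ) := by
          exact_mod_cast Finset.card_biUnion_le
      _ ≤ ∑ _S ∈ candidates N k, (1 / 16) ^ k * C := Finset.sum_le_sum (hCS k)
      _ = (candidates N k).card * ((1 / 16) ^ k * C) := by simp
      _ ≤ ((N + 1) ^ 2 * 8 ^ k) * ((1 / 16) ^ k * C) := by
          gcongr
          exact_mod_cast card_candidates_le N k
      _ = (N + 1) ^ 2 * (1 / 2) ^ k * C := by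
          rw [show (1 / 2 : ℝ) = 8 * (1 / 16) by norm_num, mul_pow]
          ring
      _ ≤ (N + 1) ^ 2 * (1 / 2) ^ ⌈lam * N⌉₊ * C := by
          gcongr (N + 1) ^ 2 * ?_ * C
          exact pow_le_pow_of_le_one (by norm_num) (by norm_num) (Finset.mem_Icc.1 hk).1
  have hKcard : (K.card : ℝ) ≤ (N + 1) ^ 4 + 1 := by
    have : K.card ≤ (N + 1) ^ 4 + 1 := by
      rw [hK, Nat.card_Icc]
      omega
    exact_mod_cast this
  calc (Nat.card (badClass p lam N) : ℝ) ≤ T.card := by exact_mod_cast hbad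
    _ ≤ ∑ k ∈ K, ((((candidates N k).biUnion fun S =>
      ((cellBonds N).powersetCard m).filter fun A => S ⊆ A).card : ℕ) : ℝ) := by
        exact_mod_cast Finset.card_biUnion_le
    _ ≤ ∑ _k ∈ K, (N + 1) ^ 2 * (1 / 2) ^ ⌈lam * N⌉₊ * C := Finset.sum_le_sum hk
    _ = K.card * ((N + 1) ^ 2 * (1 / 2) ^ ⌈lam * N⌉₊ * C) := by simp
    _ ≤ ((N + 1) ^ 4 + 1) * ((N + 1) ^ 2 * (1 / 2) ^ ⌈lam * N⌉₊ * C) := by gcongr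
    _ = _ := by ring

lemma tendsto_poly_mul_half_pow_ceil {lam : ℝ} (hlam : 0 < lam) :
    Tendsto (fun N : ℕ => (((N : ℝ) + 1) ^ 4 + 1) * (N + 1) ^ 2 * (1 / 2) ^ ⌈lam * N⌉₊)
      atTop (nhds 0) := by
  set r : ℝ := (1 / 2 : ℝ) ^ lam with hr
  have hr0 : 0 < r := Real.rpow_pos_of_pos (by norm_num) _
  have hr1 : r < 1 := Real.rpow_lt_one (by norm_num) (by norm_num) hlam
  have hlim := (tendsto_pow_const_mul_const_pow_of_abs_lt_one 6
    (show |r| < 1 by rwa [abs_of_pos hr0])).const_mul 128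
  rw [mul_zero] at hlim
  refine squeeze_zero' (Eventually.of_forall fun N => by positivity) ?_ hlim
  filter_upwards [eventually_ge_atTop 1] with N hN
  have hN1 : (1 : ℝ) ≤ N := by exact_mod_cast hN
  have hpow : (1 / 2 : ℝ) ^ ⌈lam * N⌉₊ ≤ r ^ N := by
    rw [hr, ← Real.rpow_natCast, ← Real.rpow_natCast, ← Real.rpow_mul (by norm_num)]
    exact Real.rpow_le_rpow_of_exponent_ge (by norm_num) (by norm_num) (Nat.le_ceil _)
  have h2 : (N : ℝ) + 1 ≤ 2 * N := by linarith
  have h4 : ((N : ℝ) + 1) ^ 4 + 1 ≤ 2 * (2 * N) ^ 4 := by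
    have ha : ((N : ℝ) + 1) ^ 4 ≤ (2 * N) ^ 4 := by gcongr
    have hb : (1 : ℝ) ≤ (2 * N) ^ 4 := one_le_pow₀ (by linarith)
    linarith
  calc (((N : ℝ) + 1) ^ 4 + 1) * (N + 1) ^ 2 * (1 / 2) ^ ⌈lam * N⌉₊
      ≤ (2 * (2 * N) ^ 4) * (2 * N) ^ 2 * r ^ N := by gcongr
    _ = 128 * ((N : ℝ) ^ 6 * r ^ N) := by ring

/-- There exists `p₀ > 0` (any `p` with `6e√(p(1−p)) < 1` works) such that for every
`p ∈ (0, p₀)` and `λ ∈ (0,1)`, the proportion `#ℬ^λ_p(N) / #𝒞_p(N)` of `N`-periodic spin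
systems with `⌊2pN²⌋` antiferromagnetic bonds per cell admitting a separating path of length
`≥ λN` in `[0,N]²` tends to `0` as `N → ∞`. -/
theorem bad_proportion_tendsto_zero :
    ∃ p₀ : ℝ, 0 < p₀ ∧ ∀ p : ℝ, 0 < p → p < p₀ → ∀ lam : ℝ, 0 < lam → lam < 1 →
      Filter.Tendsto
        (fun N : ℕ => (Nat.card (badClass p lam N) : ℝ) / (Nat.card (spinClass p N) : ℝ))
        Filter.atTop (nhds 0) := by
  refine ⟨(1 / 16) ^ 4, by norm_num, fun p hp0 hp lam hlam _ => ?_⟩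
  refine squeeze_zero' (Eventually.of_forall fun N => by positivity) ?_
    (tendsto_poly_mul_half_pow_ceil hlam)
  filter_upwards [eventually_gt_atTop 0] with N hN
  exact div_le_of_le_mul₀ (by positivity) (by positivity) (card_badClass_le hN hp0.le hp.le)
end

section
/- For every p ∈ (0,1/2) there exists a constant C(p) > 0 such that for every natural number N ≥ 1 and every even integer k = 2m with 1 ≤ k ≤ 4pN², g_p(k,N) := C(M,m)·C(2N²−M,m) / C(2N²,2m) ≤ C(p)·N^8·(2e√(p(1−p)))^k, where M = ⌊2pN²⌋. -/
theorem Nat.cast_choose_le_pow_mul_choose {p : ℝ} (hp0 : 0 ≤ p) (hp1 : p ≤ 1) {a n : ℕ}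
    (h : (a : ℝ) ≤ p * n) (m : ℕ) : (a.choose m : ℝ) ≤ p ^ m * n.choose m := by
  have hdesc : (a.descFactorial m : ℝ) ≤ p ^ m * n.descFactorial m := by
    induction m with
    | zero => simp
    | succ k ih =>
      rw [Nat.descFactorial_succ, Nat.descFactorial_succ]
      rcases le_total a k with hak | hka
      · rw [Nat.sub_eq_zero_of_le hak]
        simp only [zero_mul, Nat.cast_zero]
        positivity
      · have han : (a : ℝ) ≤ n := h.trans (mul_le_of_le_one_left n.cast_nonneg hp1)
        have hkn : k ≤ n := hka.trans (by exact_mod_cast han)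
        have hfactor : ((a - k : ℕ) : ℝ) ≤ p * ((n - k : ℕ) : ℝ) := by
          rw [Nat.cast_sub hka, Nat.cast_sub hkn]
          nlinarith [mul_le_of_le_one_left (k.cast_nonneg (α := ℝ)) hp1]
        push_cast
        calc ((a - k : ℕ) : ℝ) * (a.descFactorial k : ℝ)
            ≤ (p * ((n - k : ℕ) : ℝ)) * (p ^ k * n.descFactorial k) := by gcongr
          _ = p ^ (k + 1) * (((n - k : ℕ) : ℝ) * n.descFactorial k) := by ring
  rw [Nat.descFactorial_eq_factorial_mul_choose, Nat.descFactorial_eq_factorial_mul_choose] at hdesc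
  push_cast at hdesc
  have hfact : (0 : ℝ) < (m.factorial : ℝ) := by positivity
  refine le_of_mul_le_mul_left ?_ hfact
  linarith

/-- For every `p ∈ (0, 1/2)` there is `C(p) > 0` such that for all `N ≥ 1` and all even
`k = 2m` with `1 ≤ k ≤ 4pN²`,
`g_p(k,N) = C(M,m)·C(2N²−M,m)/C(2N²,2m) ≤ C(p)·N^8·(2e√(p(1−p)))^k`, where `M = ⌊2pN²⌋`. -/
theorem g_estimate (p : ℝ) (hp0 : 0 < p) (hp1 : p < 1 / 2) :
    ∃ C : ℝ, 0 < C ∧ ∀ N : ℕ, 1 ≤ N → ∀ m : ℕ, 1 ≤ 2 * m →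
      ((2 * m : ℕ) : ℝ) ≤ 4 * p * (N : ℝ) ^ 2 →
      ((⌊2 * p * (N : ℝ) ^ 2⌋₊.choose m : ℝ) *
          ((2 * N ^ 2 - ⌊2 * p * (N : ℝ) ^ 2⌋₊).choose m : ℝ)) /
        ((2 * N ^ 2).choose (2 * m) : ℝ)
      ≤ C * (N : ℝ) ^ 8 * (2 * Real.exp 1 * Real.sqrt (p * (1 - p))) ^ (2 * m) := by
  refine ⟨1, one_pos, fun N hN m _ hm => ?_⟩
  have hN' : (1 : ℝ) ≤ N := by exact_mod_cast hN
  have hMle : (⌊2 * p * (N : ℝ) ^ 2⌋₊ : ℝ) ≤ 2 * p * (N : ℝ) ^ 2 := Nat.floor_le (by positivity)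
  have hmM : m ≤ ⌊2 * p * (N : ℝ) ^ 2⌋₊ := by
    apply Nat.le_floor
    push_cast at hm
    linarith
  set M := ⌊2 * p * (N : ℝ) ^ 2⌋₊
  have h2m : 2 * m ≤ 2 * N ^ 2 := by
    have : ((2 * m : ℕ) : ℝ) ≤ ((2 * N ^ 2 : ℕ) : ℝ) := by
      push_cast at hm ⊢
      nlinarith [sq_nonneg (N : ℝ)]
    exact_mod_cast this
  set n := 2 * N ^ 2 with hn
  have hleft : (M.choose m : ℝ) ≤ p ^ m * n.choose m := by
    refine Nat.cast_choose_le_pow_mul_choose hp0.le (by linarith) ?_ m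
    rw [hn]
    push_cast
    linarith
  have hright : ((n - M).choose m : ℝ) ≤ (n - m).choose m := by
    exact_mod_cast Nat.choose_le_choose m (Nat.sub_le_sub_left hmM n)
  have htrinomial : (n.choose m : ℝ) * (n - m).choose m = n.choose (2 * m) * (2 * m).choose m := by
    have := Nat.choose_mul (n := n) (k := 2 * m) (s := m) (by omega)
    rw [show 2 * m - m = m by omega] at this
    exact_mod_cast this.symm
  have hcentral : ((2 * m).choose m : ℝ) ≤ 4 ^ m := by
    have : (2 * m).choose m ≤ 2 ^ (2 * m) := Nat.choose_le_two_pow _ _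
    rw [pow_mul] at this
    exact_mod_cast this
  have hbase : 4 * p ≤ (2 * Real.exp 1 * Real.sqrt (p * (1 - p))) ^ 2 := by
    rw [mul_pow, Real.sq_sqrt (mul_nonneg hp0.le (by linarith))]
    have he : 2 ≤ Real.exp 1 := by linarith [Real.add_one_le_exp 1]
    have he2 : 4 ≤ Real.exp 1 ^ 2 := by nlinarith
    have : 1 ≤ Real.exp 1 ^ 2 * (1 - p) := by nlinarith
    nlinarith
  have hpos : (0 : ℝ) < n.choose (2 * m) := by exact_mod_cast Nat.choose_pos h2m
  calc (M.choose m : ℝ) * (n - M).choose m / n.choose (2 * m)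
      ≤ (p ^ m * n.choose m) * (n - m).choose m / n.choose (2 * m) := by gcongr
    _ = p ^ m * (2 * m).choose m := by
        rw [mul_assoc, htrinomial]
        field_simp
    _ ≤ p ^ m * 4 ^ m := by gcongr
    _ = (4 * p) ^ m := by rw [mul_pow, mul_comm]
    _ ≤ ((2 * Real.exp 1 * Real.sqrt (p * (1 - p))) ^ 2) ^ m := by gcongr
    _ = 1 * (2 * Real.exp 1 * Real.sqrt (p * (1 - p))) ^ (2 * m) := by rw [pow_mul, one_mul]
    _ ≤ 1 * (N : ℝ) ^ 8 * (2 * Real.exp 1 * Real.sqrt (p * (1 - p))) ^ (2 * m) := by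
        rw [one_mul ((N : ℝ) ^ 8)]
        gcongr
        exact one_le_pow₀ hN'
end

section
/- Let p ∈ (0,1/2), N ≥ 1, M = ⌊2pN²⌋, and let k = 2m be an even integer with 1 ≤ k ≤ 2N² and m ≤ M. Define f_p(k,N) = ∑_{j=m}^{min(k,M)} C(k,j)·C(2N²−k, M−j) and g_p(k,N) = C(M,m)·C(2N²−M,m)/C(2N²,2m). Then f_p(k,N) / C(2N², M) ≤ (m+1)·g_p(k,N). -/
theorem Nat.choose_mul_choose_sub_comm {n a b : ℕ} :
    n.choose a * (n - a).choose b = n.choose b * (n - b).choose a := by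
  have h₁ := Nat.choose_mul (n := n) (Nat.le_add_right a b)
  have h₂ := Nat.choose_mul (n := n) (Nat.le_add_left b a)
  rw [Nat.add_sub_cancel_left] at h₁
  rw [Nat.add_sub_cancel] at h₂
  rw [← h₁, ← h₂, Nat.choose_symm_add]

/-- Symmetry of the hypergeometric weights in the sample size and the number of marked elements. -/
theorem Nat.choose_mul_choose_mul_choose_symm {n k l j : ℕ} (hjk : j ≤ k) (hjl : j ≤ l) :
    n.choose k * (k.choose j * (n - k).choose (l - j)) =
      n.choose l * (l.choose j * (n - l).choose (k - j)) := by
  have h := Nat.choose_mul_choose_sub_comm (n := n - j) (a := k - j) (b := l - j)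
  rw [show n - j - (k - j) = n - k by omega, show n - j - (l - j) = n - l by omega] at h
  rw [← mul_assoc, ← mul_assoc, Nat.choose_mul hjk, Nat.choose_mul hjl, mul_assoc, mul_assoc, h]

theorem Nat.choose_succ_mul_choose_le {a b r s : ℕ} (hab : a ≤ b) (hsr : s ≤ r) :
    a.choose (r + 1) * b.choose s ≤ a.choose r * b.choose (s + 1) := by
  refine Nat.le_of_mul_le_mul_right (c := (r + 1) * (s + 1)) ?_ (by positivity)
  calc a.choose (r + 1) * b.choose s * ((r + 1) * (s + 1))
      = a.choose (r + 1) * (r + 1) * (b.choose s * (s + 1)) := by ring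
    _ = a.choose r * b.choose s * ((a - r) * (s + 1)) := by
      rw [Nat.choose_succ_right_eq]; ring
    _ ≤ a.choose r * b.choose s * ((b - s) * (r + 1)) := by gcongr
    _ = a.choose r * (r + 1) * (b.choose s * (b - s)) := by ring
    _ = a.choose r * b.choose (s + 1) * ((r + 1) * (s + 1)) := by
      rw [← Nat.choose_succ_right_eq]; ring

theorem Nat.choose_add_mul_choose_sub_le {a b m i : ℕ} (hab : a ≤ b) (him : i ≤ m) :
    a.choose (m + i) * b.choose (m - i) ≤ a.choose m * b.choose m := by
  induction i with
  | zero => simp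
  | succ i ih =>
    refine le_trans ?_ (ih (by omega))
    have h := Nat.choose_succ_mul_choose_le (r := m + i) (s := m - (i + 1)) hab (by omega)
    rwa [show m - (i + 1) + 1 = m - i by omega] at h

/-- Let `p ∈ (0,1/2)`, `N ≥ 1`, `M = ⌊2pN²⌋` and let `k = 2m` be even with `1 ≤ k ≤ 2N²` and
`m ≤ M`. With `f_p(k,N) = ∑_{j=m}^{min(k,M)} C(k,j)·C(2N²−k, M−j)` and
`g_p(k,N) = C(M,m)·C(2N²−M,m)/C(2N²,2m)`, one has `f_p(k,N)/C(2N²,M) ≤ (m+1)·g_p(k,N)`. -/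
theorem f_le_g_estimate (p : ℝ) (hp0 : 0 < p) (hp1 : p < 1 / 2)
    (N : ℕ) (hN : 1 ≤ N) (M : ℕ) (hM : M = ⌊2 * p * (N : ℝ) ^ 2⌋₊)
    (m : ℕ) (hm1 : 1 ≤ 2 * m) (hm2 : 2 * m ≤ 2 * N ^ 2) (hm3 : m ≤ M) :
    (∑ j ∈ Finset.Icc m (min (2 * m) M),
        ((2 * m).choose j : ℝ) * ((2 * N ^ 2 - 2 * m).choose (M - j) : ℝ)) /
      ((2 * N ^ 2).choose M : ℝ)
    ≤ (m + 1 : ℝ) *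
        (((M.choose m : ℝ) * ((2 * N ^ 2 - M).choose m : ℝ)) /
          ((2 * N ^ 2).choose (2 * m) : ℝ)) := by
  have hMN : 2 * M ≤ 2 * N ^ 2 := by
    have hfloor : (M : ℝ) ≤ 2 * p * (N : ℝ) ^ 2 := hM ▸ Nat.floor_le (by positivity)
    have hle : (M : ℝ) ≤ (N : ℝ) ^ 2 := by nlinarith [sq_nonneg (N : ℝ)]
    exact Nat.mul_le_mul_left 2 (by exact_mod_cast hle)
  have hposM : (0 : ℝ) < (2 * N ^ 2).choose M := by
    exact_mod_cast Nat.choose_pos (by omega)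
  have hposm : (0 : ℝ) < (2 * N ^ 2).choose (2 * m) := by
    exact_mod_cast Nat.choose_pos hm2
  rw [Finset.sum_div]
  have hterm : ∀ j ∈ Finset.Icc m (min (2 * m) M),
      ((2 * m).choose j : ℝ) * ((2 * N ^ 2 - 2 * m).choose (M - j) : ℝ) /
          ((2 * N ^ 2).choose M : ℝ) ≤
        (M.choose m : ℝ) * ((2 * N ^ 2 - M).choose m : ℝ) /
          ((2 * N ^ 2).choose (2 * m) : ℝ) := by
    intro j hj
    rw [Finset.mem_Icc, le_min_iff] at hj
    obtain ⟨hmj, hj2, hjM⟩ := hj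
    rw [div_le_div_iff₀ hposM hposm]
    norm_cast
    rw [mul_comm, Nat.choose_mul_choose_mul_choose_symm hj2 hjM, mul_comm]
    have h := Nat.choose_add_mul_choose_sub_le (a := M) (b := 2 * N ^ 2 - M) (m := m)
      (i := j - m) (by omega) (by omega)
    rw [show m + (j - m) = j by omega, show m - (j - m) = 2 * m - j by omega] at h
    exact Nat.mul_le_mul_right _ h
  refine (Finset.sum_le_card_nsmul _ _ _ hterm).trans ?_
  rw [nsmul_eq_mul]
  gcongr
  rw [Nat.card_Icc]
  exact_mod_cast (by omega : min (2 * m) M + 1 - m ≤ m + 1)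
end

section
/- For all natural numbers n, k with 0 < k < n, 1/C(n,k) ≤ e·k·(n−k)·(k/(n−k))^k·((n−k)/n)^n. -/
theorem add_one_pow_le_pow_mul_exp_one {n : ℕ} (hn : 1 ≤ n) :
    ((n : ℝ) + 1) ^ n ≤ (n : ℝ) ^ n * Real.exp 1 := by
  have hn0 : (0 : ℝ) < n := by exact_mod_cast hn
  have h : (n : ℝ) + 1 ≤ n * Real.exp (1 / n) := by
    calc (n : ℝ) + 1 = n * (1 / n + 1) := by field_simp; ring
      _ ≤ n * Real.exp (1 / n) := by gcongr; exact Real.add_one_le_exp _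
  calc ((n : ℝ) + 1) ^ n ≤ (n * Real.exp (1 / n)) ^ n := by gcongr
    _ = (n : ℝ) ^ n * Real.exp 1 := by
      rw [mul_pow, ← Real.exp_nat_mul, mul_one_div_cancel hn0.ne']

theorem pow_succ_mul_exp_one_le (n : ℕ) :
    (n : ℝ) ^ (n + 1) * Real.exp 1 ≤ ((n : ℝ) + 1) ^ (n + 1) := by
  have hn0 : (0 : ℝ) < (n : ℝ) + 1 := by positivity
  have h : (n : ℝ) ≤ (n + 1) * Real.exp (-(1 / (n + 1))) := by
    calc (n : ℝ) = (n + 1) * (-(1 / (n + 1)) + 1) := by field_simp; ring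
      _ ≤ _ := by gcongr; exact Real.add_one_le_exp _
  calc (n : ℝ) ^ (n + 1) * Real.exp 1
      ≤ ((n + 1) * Real.exp (-(1 / (n + 1)))) ^ (n + 1) * Real.exp 1 := by gcongr
    _ = ((n : ℝ) + 1) ^ (n + 1) := by
      rw [mul_pow, ← Real.exp_nat_mul, mul_assoc, ← Real.exp_add]
      push_cast
      rw [mul_neg, mul_one_div_cancel hn0.ne', neg_add_cancel, Real.exp_zero, mul_one]

theorem pow_mul_exp_one_le_factorial_mul_exp {n : ℕ} (hn : 1 ≤ n) :
    (n : ℝ) ^ n * Real.exp 1 ≤ n.factorial * Real.exp n := by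
  induction n, hn using Nat.le_induction with
  | base => simp
  | succ n hn ih =>
    rw [Nat.factorial_succ]
    push_cast
    rw [Real.exp_add]
    calc ((n : ℝ) + 1) ^ (n + 1) * Real.exp 1
        = (n + 1) * ((n : ℝ) + 1) ^ n * Real.exp 1 := by ring
      _ ≤ (n + 1) * ((n : ℝ) ^ n * Real.exp 1) * Real.exp 1 := by
        gcongr; exact add_one_pow_le_pow_mul_exp_one hn
      _ ≤ (n + 1) * (n.factorial * Real.exp n) * Real.exp 1 := by gcongr
      _ = _ := by ring

theorem factorial_mul_exp_le_pow_succ_mul_exp_one {n : ℕ} (hn : 1 ≤ n) :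
    n.factorial * Real.exp n ≤ (n : ℝ) ^ (n + 1) * Real.exp 1 := by
  induction n, hn using Nat.le_induction with
  | base => simp
  | succ n hn ih =>
    rw [Nat.factorial_succ]
    push_cast
    rw [Real.exp_add]
    calc ((n : ℝ) + 1) * n.factorial * (Real.exp n * Real.exp 1)
        = (n + 1) * (n.factorial * Real.exp n) * Real.exp 1 := by ring
      _ ≤ (n + 1) * ((n : ℝ) ^ (n + 1) * Real.exp 1) * Real.exp 1 := by gcongr
      _ ≤ (n + 1) * ((n : ℝ) + 1) ^ (n + 1) * Real.exp 1 := by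
        gcongr; exact pow_succ_mul_exp_one_le n
      _ = _ := by ring

/-- For `0 < k < n`, `1/C(n,k) ≤ e·k·(n−k)·(k/(n−k))^k·((n−k)/n)^n`. -/
theorem one_div_choose_le (n k : ℕ) (hk0 : 0 < k) (hkn : k < n) :
    1 / (n.choose k : ℝ)
      ≤ Real.exp 1 * k * ((n : ℝ) - k) * ((k : ℝ) / ((n : ℝ) - k)) ^ k *
        (((n : ℝ) - k) / n) ^ n := by
  obtain ⟨m, hm, rfl⟩ : ∃ m, 1 ≤ m ∧ n = k + m := ⟨n - k, by omega, by omega⟩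
  have hk : (0 : ℝ) < k := by exact_mod_cast hk0
  have hm0 : (0 : ℝ) < m := by exact_mod_cast hm
  have hsub : ((k + m : ℕ) : ℝ) - k = m := by push_cast; ring
  have hn0 : (0 : ℝ) < (k + m : ℕ) := by positivity
  have hlow := pow_mul_exp_one_le_factorial_mul_exp (n := k + m) (by omega)
  have hupk := factorial_mul_exp_le_pow_succ_mul_exp_one hk0
  have hupm := factorial_mul_exp_le_pow_succ_mul_exp_one hm
  have hexp : Real.exp (k + m : ℕ) = Real.exp k * Real.exp m := by
    rw [← Real.exp_add]; push_cast; rfl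
  have hrhs : Real.exp 1 * k * m * ((k : ℝ) / m) ^ k * ((m : ℝ) / (k + m : ℕ)) ^ (k + m)
      = (k : ℝ) ^ (k + 1) * Real.exp 1 * ((m : ℝ) ^ (m + 1) * Real.exp 1) /
        (((k + m : ℕ) : ℝ) ^ (k + m) * Real.exp 1) := by
    rw [div_pow, div_pow, pow_add (m : ℝ) k m]
    field_simp
    ring
  rw [hsub, hrhs, Nat.cast_choose ℝ (Nat.le_add_right k m), Nat.add_sub_cancel_left, one_div_div]
  calc (k.factorial : ℝ) * m.factorial / (k + m).factorial
      = k.factorial * Real.exp k * (m.factorial * Real.exp m) /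
        ((k + m).factorial * Real.exp (k + m : ℕ)) := by
        rw [hexp]
        field_simp
    _ ≤ _ := by gcongr
end
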